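/- Under the decay condition (D) with parameter θ ∈ (0,1/2), for weighting vectors v_n, w_n, ṽ_n, w̃_n with finite ℓ1-norms and K_n = ‖v_n‖_{ℓ1}‖w_n‖_{ℓ1}‖ṽ_n‖_{ℓ1}‖w̃_n‖_{ℓ1}, there is a constant C such that for all n: (i) |f̃_{ℓ,0}(𝔞,v_n,w_n)| ≤ C‖v_n‖_{ℓ1}‖w_n‖_{ℓ1}·ℓ^{−1/2−(3/4)θ} for all ℓ ≥ 1; (ii) Σ_{j=1}^{n'} (Σ_{ℓ=j}^∞ f̃_{ℓ,0}(𝔟,v_n,w_n)²)·(Σ_{ℓ=j}^∞ f̃_{ℓ,0}(𝔠,ṽ_n,w̃_n)²) ≤ C·K_n²·(n')^{1−θ} for all n' ≥ 1; (iii) Σ_{j=1}^{n'} Σ_{ℓ=j}^∞ |f̃_{ℓ,0}(𝔟,v_n,w_n)·f̃_{ℓ,0}(𝔠,ṽ_n,w̃_n)| ≤ C·K_n·(n')^{1−θ} for all n' ≥ 1. -/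

import Mathlib

noncomputable section

/-- The coefficients `f_{ℓ,j}(𝔞, v, w)`. -/
def fCoef (d : ℕ) (a : ℕ → ℕ → ℝ) (v w : ℕ → ℝ) (ℓ j : ℕ) : ℝ :=
  if ℓ = 0 then
    ∑ ν ∈ Finset.range d, ∑ μ ∈ Finset.range d, v ν * w μ * (a j ν * a j μ)
  else
    ∑ ν ∈ Finset.range d, ∑ μ ∈ Finset.range d,
      v ν * w μ * (a j ν * a (j + ℓ) μ + a j μ * a (j + ℓ) ν)

/-- `f̃_{ℓ,i}(𝔞, v, w) = Σ_{j ≥ i} f_{ℓ,j}(𝔞, v, w)`. -/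
def fTilde (d : ℕ) (a : ℕ → ℕ → ℝ) (v w : ℕ → ℝ) (ℓ i : ℕ) : ℝ :=
  ∑' j : ℕ, fCoef d a v w ℓ (i + j)

/-- The ℓ¹-norm of a weighting vector in `ℝ^d`. -/
def l1norm (d : ℕ) (v : ℕ → ℝ) : ℝ := ∑ ν ∈ Finset.range d, |v ν|

/-- A uniform bound on the products of coefficients bounds `fCoef` by the `ℓ¹`-norms of the weights. -/
theorem abs_fCoef_le {d : ℕ} {a : ℕ → ℕ → ℝ} (v w : ℕ → ℝ) {ℓ j : ℕ} (hℓ : 1 ≤ ℓ) {x y : ℝ}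
    (hx : ∀ ν < d, |a j ν| ≤ x) (hy : ∀ ν < d, |a (j + ℓ) ν| ≤ y) :
    |fCoef d a v w ℓ j| ≤ 2 * (x * y) * (l1norm d v * l1norm d w) := by
  have hprod : ∀ ν < d, ∀ μ < d, |a j ν * a (j + ℓ) μ| ≤ x * y := fun ν hν μ hμ => by
    rw [abs_mul]
    exact mul_le_mul (hx ν hν) (hy μ hμ) (abs_nonneg _) ((abs_nonneg _).trans (hx ν hν))
  rw [fCoef, if_neg (by omega), l1norm, l1norm, Finset.sum_mul_sum, Finset.mul_sum]
  refine (Finset.abs_sum_le_sum_abs _ _).trans (Finset.sum_le_sum fun ν hν => ?_)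
  rw [Finset.mul_sum]
  refine (Finset.abs_sum_le_sum_abs _ _).trans (Finset.sum_le_sum fun μ hμ => ?_)
  rw [Finset.mem_range] at hν hμ
  rw [abs_mul, abs_mul, mul_comm]
  refine mul_le_mul_of_nonneg_right ?_ (by positivity)
  have h := abs_add_le (a j ν * a (j + ℓ) μ) (a j μ * a (j + ℓ) ν)
  linarith [hprod ν hν μ hμ, hprod μ hμ ν hν]

theorem l1norm_nonneg (d : ℕ) (v : ℕ → ℝ) : 0 ≤ l1norm d v :=
  Finset.sum_nonneg fun _ _ => abs_nonneg _

/-- Powers of `max j 1` with exponent below `-1` are summable. -/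
theorem summable_max_one_rpow {q : ℝ} (hq : q < -1) :
    Summable fun j : ℕ => ((max j 1 : ℕ) : ℝ) ^ q := by
  rw [← summable_nat_add_iff 1]
  simpa using (summable_nat_add_iff 1).2 (Real.summable_nat_rpow.2 hq)

/-- Splitting off a power of `ℓ` from the shifted decay leaves a factor decaying in `j`. -/
theorem rpow_mul_add_rpow_le {p s : ℝ} (hs : 0 ≤ s) (hps : s ≤ p) {ℓ : ℕ} (hℓ : 1 ≤ ℓ) (j : ℕ) :
    ((max j 1 : ℕ) : ℝ) ^ (-p) * ((max (j + ℓ) 1 : ℕ) : ℝ) ^ (-p)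
      ≤ ((max j 1 : ℕ) : ℝ) ^ (-(2 * p - s)) * (ℓ : ℝ) ^ (-s) := by
  have hm : (0 : ℝ) < ((max j 1 : ℕ) : ℝ) := by exact_mod_cast (by omega : 0 < max j 1)
  have hM : (0 : ℝ) < ((max (j + ℓ) 1 : ℕ) : ℝ) := by
    exact_mod_cast (by omega : 0 < max (j + ℓ) 1)
  have hl : (0 : ℝ) < (ℓ : ℝ) := by exact_mod_cast hℓ
  have hjM : ((max j 1 : ℕ) : ℝ) ≤ ((max (j + ℓ) 1 : ℕ) : ℝ) := by
    exact_mod_cast (by omega : max j 1 ≤ max (j + ℓ) 1)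
  have hlM : (ℓ : ℝ) ≤ ((max (j + ℓ) 1 : ℕ) : ℝ) := by
    exact_mod_cast (by omega : ℓ ≤ max (j + ℓ) 1)
  rw [show -(2 * p - s) = -p + -(p - s) by ring, Real.rpow_add hm, mul_assoc]
  refine mul_le_mul_of_nonneg_left ?_ (by positivity)
  rw [show -p = -(p - s) + -s by ring, Real.rpow_add hM]
  exact mul_le_mul (Real.rpow_le_rpow_of_nonpos hm hjM (by linarith))
    (Real.rpow_le_rpow_of_nonpos hl hlM (by linarith)) (by positivity) (by positivity)

/-- Power decay of `fTilde` in the lag `ℓ`, from power decay of the coefficients. -/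
theorem abs_fTilde_le {p s K : ℝ} (hs : 0 ≤ s) (hps : s ≤ p) (hsum : 1 < 2 * p - s)
    {d : ℕ} {a : ℕ → ℕ → ℝ} (v w : ℕ → ℝ)
    (ha : ∀ j ν, ν < d → |a j ν| ≤ K * ((max j 1 : ℕ) : ℝ) ^ (-p)) {ℓ : ℕ} (hℓ : 1 ≤ ℓ) :
    |fTilde d a v w ℓ 0| ≤
      2 * K ^ 2 * (∑' j : ℕ, ((max j 1 : ℕ) : ℝ) ^ (-(2 * p - s)))
        * (l1norm d v * l1norm d w) * (ℓ : ℝ) ^ (-s) := by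
  have hS := (summable_max_one_rpow (q := -(2 * p - s)) (by linarith)).hasSum.mul_left
    (2 * K ^ 2 * (l1norm d v * l1norm d w) * (ℓ : ℝ) ^ (-s))
  rw [fTilde, ← Real.norm_eq_abs, mul_right_comm (2 * K ^ 2), mul_right_comm (2 * K ^ 2 * _)]
  refine tsum_of_norm_bounded hS fun j => ?_
  rw [Real.norm_eq_abs, zero_add]
  refine (abs_fCoef_le v w hℓ (ha j) (ha (j + ℓ))).trans ?_
  have h := mul_le_mul_of_nonneg_left (rpow_mul_add_rpow_le hs hps hℓ j)
    (show 0 ≤ 2 * K ^ 2 * (l1norm d v * l1norm d w) from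
      mul_nonneg (by positivity) (mul_nonneg (l1norm_nonneg d v) (l1norm_nonneg d w)))
  linear_combination h

theorem sum_Icc_rpow_neg_le {θ : ℝ} (hθ0 : 0 < θ) (hθ1 : θ ≤ 1 / 2) (N : ℕ) :
    ∑ j ∈ Finset.Icc 1 N, (j : ℝ) ^ (-θ) ≤ 2 * (N : ℝ) ^ (1 - θ) := by
  induction N with
  | zero => simp [Real.zero_rpow (by linarith : 1 - θ ≠ 0)]
  | succ N ih =>
    rw [Finset.sum_Icc_succ_top (by omega)]
    have hN : (0 : ℝ) < ((N + 1 : ℕ) : ℝ) := by positivity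
    have hpos : 0 < ((N + 1 : ℕ) : ℝ) ^ (-θ) := by positivity
    have hgm := mul_le_mul_of_nonneg_right
      (Real.geom_mean_le_arith_mean2_weighted (by linarith : 0 ≤ 1 - θ) hθ0.le
        (Nat.cast_nonneg N) hN.le (by ring)) hpos.le
    rw [mul_assoc, ← Real.rpow_add hN, add_neg_cancel, Real.rpow_zero, mul_one] at hgm
    have hsplit : ((N + 1 : ℕ) : ℝ) ^ (1 - θ) = ((N + 1 : ℕ) : ℝ) * ((N + 1 : ℕ) : ℝ) ^ (-θ) := by
      rw [sub_eq_add_neg, Real.rpow_add hN, Real.rpow_one]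
    rw [hsplit]
    push_cast at *
    nlinarith

/-- Tail sums of products of two sequences of order `ℓ ^ (-1/2 - 3θ/4)` are of order `j ^ (-θ)`. -/
theorem tsum_abs_mul_le {θ A B : ℝ} (hθ : 0 < θ) {f g : ℕ → ℝ}
    (hf : ∀ ℓ, 1 ≤ ℓ → |f ℓ| ≤ A * (ℓ : ℝ) ^ (-(1 / 2 + 3 / 4 * θ)))
    (hg : ∀ ℓ, 1 ≤ ℓ → |g ℓ| ≤ B * (ℓ : ℝ) ^ (-(1 / 2 + 3 / 4 * θ)))
    {j : ℕ} (hj : 1 ≤ j) :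
    ∑' ℓ : ℕ, |f (j + ℓ) * g (j + ℓ)| ≤
      A * B * (∑' ℓ : ℕ, ((max ℓ 1 : ℕ) : ℝ) ^ (-(1 + θ / 2))) * (j : ℝ) ^ (-θ) := by
  have hA : 0 ≤ A := by simpa using (abs_nonneg _).trans (hf 1 le_rfl)
  have hB : 0 ≤ B := by simpa using (abs_nonneg _).trans (hg 1 le_rfl)
  have hS := (summable_max_one_rpow (q := -(1 + θ / 2)) (by linarith)).hasSum.mul_left
    (A * B * (j : ℝ) ^ (-θ))
  rw [mul_right_comm]
  refine (Real.le_norm_self _).trans (tsum_of_norm_bounded hS fun ℓ => ?_)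
  have hj0 : (0 : ℝ) < (j : ℝ) := by exact_mod_cast hj
  have hm : (0 : ℝ) < ((max ℓ 1 : ℕ) : ℝ) := by exact_mod_cast (by omega : 0 < max ℓ 1)
  have hM : (0 : ℝ) < ((j + ℓ : ℕ) : ℝ) := by exact_mod_cast (by omega : 0 < j + ℓ)
  have hjM : (j : ℝ) ≤ ((j + ℓ : ℕ) : ℝ) := by exact_mod_cast (by omega : j ≤ j + ℓ)
  have hmM : ((max ℓ 1 : ℕ) : ℝ) ≤ ((j + ℓ : ℕ) : ℝ) := by
    exact_mod_cast (by omega : max ℓ 1 ≤ j + ℓ)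
  rw [Real.norm_eq_abs, abs_abs, abs_mul]
  calc |f (j + ℓ)| * |g (j + ℓ)|
      ≤ A * ((j + ℓ : ℕ) : ℝ) ^ (-(1 / 2 + 3 / 4 * θ)) *
          (B * ((j + ℓ : ℕ) : ℝ) ^ (-(1 / 2 + 3 / 4 * θ))) :=
        mul_le_mul (hf _ (by omega)) (hg _ (by omega)) (abs_nonneg _) (by positivity)
    _ = A * B * (((j + ℓ : ℕ) : ℝ) ^ (-θ) * ((j + ℓ : ℕ) : ℝ) ^ (-(1 + θ / 2))) := by
        rw [mul_mul_mul_comm, ← Real.rpow_add hM, ← Real.rpow_add hM]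
        ring_nf
    _ ≤ A * B * ((j : ℝ) ^ (-θ) * ((max ℓ 1 : ℕ) : ℝ) ^ (-(1 + θ / 2))) :=
        mul_le_mul_of_nonneg_left
          (mul_le_mul (Real.rpow_le_rpow_of_nonpos hj0 hjM (by linarith))
            (Real.rpow_le_rpow_of_nonpos hm hmM (by linarith)) (by positivity) (by positivity))
          (by positivity)
    _ = _ := by ring

/-- bounds on the coefficients `f̃_{ℓ,0}` under the decay condition (D). -/
theorem fTilde_bounds
    (θ : ℝ) (hθ0 : 0 < θ) (hθ1 : θ < 1 / 2)
    (d : ℕ → ℕ) (b c : ℕ → ℕ → ℕ → ℝ) (v w vt wt : ℕ → ℕ → ℝ)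
    (Cdec : ℝ)
    (hbD : ∀ n j ν, ν < d n →
      |b n j ν| ≤ Cdec * ((max j 1 : ℕ) : ℝ) ^ (-(3 / 4 : ℝ) - θ / 2))
    (hcD : ∀ n j ν, ν < d n →
      |c n j ν| ≤ Cdec * ((max j 1 : ℕ) : ℝ) ^ (-(3 / 4 : ℝ) - θ / 2)) :
    ∃ C : ℝ, ∀ n : ℕ,
      (∀ ℓ : ℕ, 1 ≤ ℓ → ∀ a ∈ ({b, c} : Set (ℕ → ℕ → ℕ → ℝ)),
        |fTilde (d n) (a n) (v n) (w n) ℓ 0|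
          ≤ C * l1norm (d n) (v n) * l1norm (d n) (w n) * (ℓ : ℝ) ^ (-(1 / 2 : ℝ) - 3 / 4 * θ)) ∧
      (∀ n' : ℕ, 1 ≤ n' →
        ∑ j ∈ Finset.Icc 1 n',
          (∑' ℓ : ℕ, (fTilde (d n) (b n) (v n) (w n) (j + ℓ) 0) ^ 2) *
            (∑' ℓ : ℕ, (fTilde (d n) (c n) (vt n) (wt n) (j + ℓ) 0) ^ 2)
          ≤ C * (l1norm (d n) (v n) * l1norm (d n) (w n) * l1norm (d n) (vt n) *
              l1norm (d n) (wt n)) ^ 2 * (n' : ℝ) ^ ((1 : ℝ) - θ)) ∧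
      (∀ n' : ℕ, 1 ≤ n' →
        ∑ j ∈ Finset.Icc 1 n',
          (∑' ℓ : ℕ, |fTilde (d n) (b n) (v n) (w n) (j + ℓ) 0 *
            fTilde (d n) (c n) (vt n) (wt n) (j + ℓ) 0|)
          ≤ C * (l1norm (d n) (v n) * l1norm (d n) (w n) * l1norm (d n) (vt n) *
              l1norm (d n) (wt n)) * (n' : ℝ) ^ ((1 : ℝ) - θ)) := by
  set M : ℝ := 2 * Cdec ^ 2 *
    ∑' j : ℕ, ((max j 1 : ℕ) : ℝ) ^ (-(2 * (3 / 4 + θ / 2) - (1 / 2 + 3 / 4 * θ)))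
  set T : ℝ := ∑' ℓ : ℕ, ((max ℓ 1 : ℕ) : ℝ) ^ (-(1 + θ / 2))
  have hM0 : 0 ≤ M := mul_nonneg (by positivity) (tsum_nonneg fun _ => by positivity)
  have hT0 : 0 ≤ T := tsum_nonneg fun _ => by positivity
  have decay : ∀ a : ℕ → ℕ → ℕ → ℝ, (∀ n j ν, ν < d n →
      |a n j ν| ≤ Cdec * ((max j 1 : ℕ) : ℝ) ^ (-(3 / 4 : ℝ) - θ / 2)) →
      ∀ (v w : ℕ → ℝ) (n ℓ : ℕ), 1 ≤ ℓ → |fTilde (d n) (a n) v w ℓ 0| ≤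
        M * (l1norm (d n) v * l1norm (d n) w) * (ℓ : ℝ) ^ (-(1 / 2 + 3 / 4 * θ)) := by
    intro a ha v w n ℓ hℓ
    refine abs_fTilde_le (by linarith) (by linarith) (by linarith) v w (fun j ν hν => ?_) hℓ
    rw [neg_add']
    exact ha n j ν hν
  refine ⟨M + 2 * (M ^ 4 * T ^ 2) + 2 * (M ^ 2 * T), fun n => ?_⟩
  have hv := l1norm_nonneg (d n) (v n)
  have hw := l1norm_nonneg (d n) (w n)
  have hvt := l1norm_nonneg (d n) (vt n)
  have hwt := l1norm_nonneg (d n) (wt n)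
  have hb := decay b hbD (v n) (w n) n
  have hc := decay c hcD (vt n) (wt n) n
  set V := l1norm (d n) (v n)
  set W := l1norm (d n) (w n)
  set V' := l1norm (d n) (vt n)
  set W' := l1norm (d n) (wt n)
  refine ⟨fun ℓ hℓ a ha => ?_, fun N _ => ?_, fun N _ => ?_⟩
  · have h : |fTilde (d n) (a n) (v n) (w n) ℓ 0| ≤
        M * (V * W) * (ℓ : ℝ) ^ (-(1 / 2 + 3 / 4 * θ)) := by
      rcases ha with rfl | rfl
      · exact decay _ hbD (v n) (w n) n ℓ hℓ
      · exact decay _ hcD (v n) (w n) n ℓ hℓ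
    rw [neg_add'] at h
    refine h.trans ?_
    rw [← mul_assoc]
    gcongr
    linarith [show 0 ≤ M ^ 4 * T ^ 2 by positivity, show 0 ≤ M ^ 2 * T by positivity]
  · calc _ ≤ ∑ j ∈ Finset.Icc 1 N, M ^ 4 * T ^ 2 * (V * W * V' * W') ^ 2 * (j : ℝ) ^ (-θ) := by
          refine Finset.sum_le_sum fun j hj => ?_
          have hj1 := (Finset.mem_Icc.1 hj).1
          have h₁ := tsum_abs_mul_le hθ0 hb hb hj1
          have h₂ := tsum_abs_mul_le hθ0 hc hc hj1
          simp only [← pow_two, abs_sq] at h₁ h₂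
          refine (mul_le_mul h₁ h₂ (tsum_nonneg fun _ => sq_nonneg _) (by positivity)).trans ?_
          have hle : (j : ℝ) ^ (-θ) ≤ 1 :=
            Real.rpow_le_one_of_one_le_of_nonpos (by exact_mod_cast hj1) (by linarith)
          calc _ = M ^ 4 * T ^ 2 * (V * W * V' * W') ^ 2 * (j : ℝ) ^ (-θ) * (j : ℝ) ^ (-θ) := by
                ring
            _ ≤ _ := mul_le_of_le_one_right (by positivity) hle
      _ ≤ M ^ 4 * T ^ 2 * (V * W * V' * W') ^ 2 * (2 * (N : ℝ) ^ (1 - θ)) := by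
          rw [← Finset.mul_sum]
          exact mul_le_mul_of_nonneg_left (sum_Icc_rpow_neg_le hθ0 hθ1.le N) (by positivity)
      _ = 2 * (M ^ 4 * T ^ 2) * (V * W * V' * W') ^ 2 * (N : ℝ) ^ (1 - θ) := by ring
      _ ≤ _ := by
          gcongr
          linarith [show 0 ≤ M ^ 2 * T by positivity]
  · calc _ ≤ ∑ j ∈ Finset.Icc 1 N, M ^ 2 * T * (V * W * V' * W') * (j : ℝ) ^ (-θ) := by
          refine Finset.sum_le_sum fun j hj => ?_
          exact (tsum_abs_mul_le hθ0 hb hc (Finset.mem_Icc.1 hj).1).trans_eq (by ring)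
      _ ≤ M ^ 2 * T * (V * W * V' * W') * (2 * (N : ℝ) ^ (1 - θ)) := by
          rw [← Finset.mul_sum]
          exact mul_le_mul_of_nonneg_left (sum_Icc_rpow_neg_le hθ0 hθ1.le N) (by positivity)
      _ = 2 * (M ^ 2 * T) * (V * W * V' * W') * (N : ℝ) ^ (1 - θ) := by ring
      _ ≤ _ := by
          gcongr
          linarith [show 0 ≤ M ^ 4 * T ^ 2 by positivity]

end
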